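/- Let σ ≥ 1. Then for all ξ, η ∈ ℝ³ one has |ξ|^{1/σ} ≤ max(|ξ−η|, |η|)^{1/σ} + (1/σ)·min(|ξ−η|, |η|)^{1/σ}. -/

import Mathlib

open Real

noncomputable section

/-- ℝ³ as a Euclidean space. -/
abbrev E3 := EuclideanSpace ℝ (Fin 3)

/-- A refined subadditivity of `x ↦ x ^ p` for `0 < p ≤ 1`: the smaller summand gains a factor
`p`. -/
theorem add_rpow_le_rpow_add_mul_rpow {M m p : ℝ} (hm : 0 ≤ m) (hmM : m ≤ M)
    (hp0 : 0 < p) (hp1 : p ≤ 1) : (M + m) ^ p ≤ M ^ p + p * m ^ p := by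
  rcases (hm.trans hmM).eq_or_lt with rfl | hM
  · obtain rfl := le_antisymm hmM hm
    simp [Real.zero_rpow hp0.ne']
  have ht0 : 0 ≤ m / M := by positivity
  have ht1 : m / M ≤ 1 := (div_le_one hM).2 hmM
  have hle : m / M ≤ (m / M) ^ p := Real.self_le_rpow_of_le_one ht0 ht1 hp1
  calc (M + m) ^ p = M ^ p * (1 + m / M) ^ p := by
        rw [← Real.mul_rpow hM.le (by positivity)]
        congr 1
        field_simp
    _ ≤ M ^ p * (1 + p * (m / M)) := by
        gcongr
        exact rpow_one_add_le_one_add_mul_self (by linarith) hp0.le hp1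
    _ ≤ M ^ p * (1 + p * (m / M) ^ p) := by gcongr
    _ = M ^ p + p * m ^ p := by
        rw [Real.div_rpow hm hM.le]
        have : M ^ p ≠ 0 := (Real.rpow_pos_of_pos hM p).ne'
        field_simp

/-- For `σ ≥ 1` and all `ξ, η ∈ ℝ³`,
`|ξ|^{1/σ} ≤ max(|ξ-η|, |η|)^{1/σ} + (1/σ) min(|ξ-η|, |η|)^{1/σ}`. -/
theorem norm_rpow_triangle (σ : ℝ) (hσ : 1 ≤ σ) (ξ η : E3) :
    ‖ξ‖ ^ (1 / σ) ≤
      (max ‖ξ - η‖ ‖η‖) ^ (1 / σ) + (1 / σ) * (min ‖ξ - η‖ ‖η‖) ^ (1 / σ) := by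
  have hσ0 : 0 < σ := by linarith
  have htri : ‖ξ‖ ≤ max ‖ξ - η‖ ‖η‖ + min ‖ξ - η‖ ‖η‖ := by
    rw [max_add_min]
    exact norm_le_norm_sub_add ξ η
  exact (Real.rpow_le_rpow (norm_nonneg ξ) htri (by positivity)).trans
    (add_rpow_le_rpow_add_mul_rpow (le_min (norm_nonneg _) (norm_nonneg _)) min_le_max
      (by positivity) ((div_le_one hσ0).2 hσ))
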